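/- For every continuous map φ : ℝ → U(1) there exists a continuous map ψ : ℝ → U(1) such that ψ(x+1) = φ(x) ψ(x) for all x ∈ ℝ. -/

import Mathlib

/-- A continuous function vanishing near `-∞` is the difference `g (x + 1) - g x` of a continuous
function `g`, namely of the locally finite sum `∑ k, h (x - (k + 1))`. -/
theorem exists_continuous_add_one_eq_add_of_eq_zero {M : Type*} [AddCommMonoid M]
    [TopologicalSpace M] [ContinuousAdd M] {h : ℝ → M} (hh : Continuous h) {a : ℝ}
    (ha : ∀ x ≤ a, h x = 0) :
    ∃ g : ℝ → M, Continuous g ∧ ∀ x, g (x + 1) = g x + h x := by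
  let g : ℝ → M := fun x ↦ ∑ k ∈ Finset.range ⌈x - a⌉₊, h (x - (k + 1))
  have key (x : ℝ) (N : ℕ) (hN : x - a ≤ N) : g x = ∑ k ∈ Finset.range N, h (x - (k + 1)) := by
    refine Finset.sum_subset (by simpa using hN) fun k _ hk ↦ ha _ ?_
    have : x - a ≤ k := by simpa using hk
    linarith
  refine ⟨g, continuous_iff_continuousAt.2 fun x ↦ ?_, fun x ↦ ?_⟩
  · obtain ⟨N, hN⟩ := exists_nat_gt (x - a)
    have hc : Continuous fun y : ℝ ↦ ∑ k ∈ Finset.range N, h (y - (k + 1)) := by fun_prop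
    refine hc.continuousAt.congr ?_
    filter_upwards [Iio_mem_nhds (show x < N + a by linarith)] with y hy
    exact (key y N (by linarith [Set.mem_Iio.1 hy])).symm
  · obtain ⟨N, hN⟩ := exists_nat_ge (x - a)
    rw [key x N hN, key (x + 1) (N + 1) (by push_cast; linarith), Finset.sum_range_succ']
    congr 1
    · refine Finset.sum_congr rfl fun k _ ↦ congrArg h ?_
      push_cast
      ring
    · simp

/-- Every continuous real function is the difference `g (x + 1) - g x` of a continuous `g`. -/
theorem exists_continuous_add_one_eq_add {f : ℝ → ℝ} (hf : Continuous f) :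
    ∃ g : ℝ → ℝ, Continuous g ∧ ∀ x, g (x + 1) = g x + f x := by
  let c : ℝ → ℝ := fun x ↦ max 0 (min 1 x)
  have hc : Continuous c := by fun_prop
  obtain ⟨g₁, hg₁, h₁⟩ := exists_continuous_add_one_eq_add_of_eq_zero
    (h := fun x ↦ c x * f x) (hc.mul hf) (a := 0) fun x hx ↦ by
      have : c x = 0 := max_eq_left ((min_le_right _ _).trans hx)
      simp [this]
  obtain ⟨g₂, hg₂, h₂⟩ := exists_continuous_add_one_eq_add_of_eq_zero
    (h := fun x ↦ -((1 - c (-x - 1)) * f (-x - 1))) (by fun_prop) (a := -2) fun x hx ↦ by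
      have : c (-x - 1) = 1 := by
        simp only [c]
        rw [min_eq_left (by linarith), max_eq_right zero_le_one]
      simp [this]
  refine ⟨fun x ↦ g₁ x + g₂ (-x), by fun_prop, fun x ↦ ?_⟩
  have h := h₂ (-(x + 1))
  rw [show -(x + 1) + 1 = -x by ring, show -(-(x + 1)) - 1 = x by ring] at h
  linear_combination h₁ x - h

/-- A continuous map from `ℝ` to the circle has a continuous logarithm. -/
theorem Circle.exists_continuous_exp_eq {φ : ℝ → Circle} (hφ : Continuous φ) :
    ∃ f : ℝ → ℝ, Continuous f ∧ ∀ x, Circle.exp (f x) = φ x := by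
  obtain ⟨t, ht⟩ := Circle.exp_surjective (φ 0)
  obtain ⟨F, ⟨-, hF⟩, -⟩ :=
    Circle.isCoveringMap_exp.existsUnique_continuousMap_lifts ⟨φ, hφ⟩ 0 t ht
  exact ⟨F, F.continuous, congrFun hF⟩

/-- **Statement 18.** For every continuous map `φ : ℝ → U(1)` there exists a continuous
map `ψ : ℝ → U(1)` such that `ψ(x+1) = φ(x)ψ(x)` for all `x ∈ ℝ`. -/
theorem exists_continuous_solution_of_translation_equation
    (φ : ℝ → Circle) (hφ : Continuous φ) :
    ∃ ψ : ℝ → Circle, Continuous ψ ∧ ∀ x : ℝ, ψ (x + 1) = φ x * ψ x := by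
  obtain ⟨f, hf, hfφ⟩ := Circle.exists_continuous_exp_eq hφ
  obtain ⟨g, hg, hgf⟩ := exists_continuous_add_one_eq_add hf
  refine ⟨fun x ↦ Circle.exp (g x), by fun_prop, fun x ↦ ?_⟩
  simp only [hgf, Circle.exp_add, hfφ, mul_comm]
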